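/- Let N ≥ 2 be an even integer and R a real number with 0 < R < 1. Then ln R − ln(1 − R²) + Σ_{l=1}^{N−1} Σ_{n=1}^{∞} cos(2πnl/N)(−1)^l R^{2n}/n + ln(4/N) = ln( (4R/N) · (1 + R^N)/(1 − R^N) ). -/

import Mathlib

open Finset in
theorem sum_range_cos_two_pi_mul_div (N : ℕ) (hN : N ≠ 0) (k : ℕ) :
    ∑ l ∈ range N, Real.cos (2 * Real.pi * k * l / N) = if N ∣ k then (N : ℝ) else 0 := by
  have hζ := Complex.isPrimitiveRoot_exp N hN
  set ζ := Complex.exp (2 * Real.pi * Complex.I / N) with hζdef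
  have hcos (l : ℕ) : Real.cos (2 * Real.pi * k * l / N) = ((ζ ^ k) ^ l).re := by
    rw [← Complex.exp_ofReal_mul_I_re, hζdef, ← Complex.exp_nat_mul, ← Complex.exp_nat_mul]
    congr 2
    push_cast
    ring
  simp_rw [hcos, ← Complex.re_sum]
  split_ifs with h
  · simp [(hζ.pow_eq_one_iff_dvd k).2 h]
  · have hne : ζ ^ k ≠ 1 := fun h' => h ((hζ.pow_eq_one_iff_dvd k).1 h')
    rw [geom_sum_eq hne, ← pow_mul, mul_comm, pow_mul, hζ.pow_eq_one]
    simp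

open Finset in
theorem sum_Ico_cos_mul_neg_one_pow (m : ℕ) (hm : m ≠ 0) (k : ℕ) :
    ∑ l ∈ Ico 1 (2 * m), Real.cos (2 * Real.pi * k * l / (2 * m : ℕ)) * (-1 : ℝ) ^ l =
      (if 2 * m ∣ k + m then (2 * m : ℝ) else 0) - 1 := by
  have hshift (l : ℕ) : Real.cos (2 * Real.pi * k * l / (2 * m : ℕ)) * (-1 : ℝ) ^ l =
      Real.cos (2 * Real.pi * (k + m : ℕ) * l / (2 * m : ℕ)) := by
    have hm' : (m : ℝ) ≠ 0 := by exact_mod_cast hm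
    rw [mul_comm, ← Real.cos_add_nat_mul_pi]
    congr 1
    push_cast
    field_simp
  have h := sum_range_cos_two_pi_mul_div (2 * m) (by omega) (k + m)
  rw [range_eq_Ico, sum_eq_sum_Ico_succ_bot (by omega)] at h
  simp_rw [hshift]
  push_cast at h ⊢
  simp only [mul_zero, zero_div, Real.cos_zero] at h
  linarith

theorem hasSum_pow_div_of_dvd_add (m : ℕ) (hm : m ≠ 0) (R : ℝ) (hR0 : 0 < R) (hR1 : R < 1) :
    HasSum (fun n : ℕ => (if 2 * m ∣ n + 1 + m then (2 * m : ℝ) else 0) *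
      (R ^ (2 * (n + 1)) / (n + 1)))
      (Real.log (1 + R ^ (2 * m)) - Real.log (1 - R ^ (2 * m))) := by
  have hx : |R ^ (2 * m)| < 1 := by
    rw [abs_of_pos (by positivity)]
    exact pow_lt_one₀ hR0.le hR1 (by omega)
  have hpos (k : ℕ) : m * (2 * k + 1) - 1 + 1 = m * (2 * k + 1) :=
    Nat.sub_add_cancel (Nat.mul_pos (Nat.pos_of_ne_zero hm) (by omega))
  have hinj : Function.Injective fun k : ℕ => m * (2 * k + 1) - 1 := by
    intro a b hab
    have h : m * (2 * a + 1) = m * (2 * b + 1) := by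
      rw [← hpos a, ← hpos b]
      exact congrArg (· + 1) hab
    have := Nat.eq_of_mul_eq_mul_left (Nat.pos_of_ne_zero hm) h
    omega
  refine (hinj.hasSum_iff ?_).1 ?_
  · intro n hn
    rw [if_neg, zero_mul]
    rintro ⟨c, hc⟩
    obtain _ | c := c
    · omega
    · refine hn ⟨c, ?_⟩
      have : n + 1 = m * (2 * c + 1) := by linarith
      simp only [← this, Nat.add_sub_cancel]
  · convert! Real.hasSum_log_sub_log_of_abs_lt_one hx using 2 with k
    simp only [Function.comp_apply]
    have hcast : ((m * (2 * k + 1) - 1 : ℕ) : ℝ) + 1 = m * (2 * k + 1) := by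
      exact_mod_cast hpos k
    have hm' : (m : ℝ) ≠ 0 := by exact_mod_cast hm
    rw [hpos, hcast, if_pos ⟨k + 1, by ring⟩, ← pow_mul, mul_assoc 2 m]
    field_simp

/-- For `N ≥ 2` even and `0 < R < 1`,
`ln R − ln(1 − R²) + Σ_{l=1}^{N−1} Σ_{n=1}^{∞} cos(2πnl/N)(−1)^l R^{2n}/n + ln(4/N)
  = ln((4R/N)·(1 + R^N)/(1 − R^N))`. -/
theorem upsilon_tilde_half_mode (N : ℕ) (hN : 2 ≤ N) (hNeven : Even N)
    (R : ℝ) (hR0 : 0 < R) (hR1 : R < 1) :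
    Real.log R - Real.log (1 - R ^ 2) +
        (∑ l ∈ Finset.Ico 1 N, ∑' n : ℕ,
          Real.cos (2 * Real.pi * (n + 1) * l / N) * (-1 : ℝ) ^ l *
            R ^ (2 * (n + 1)) / (n + 1)) +
        Real.log (4 / (N : ℝ))
      = Real.log (4 * R / (N : ℝ) * ((1 + R ^ N) / (1 - R ^ N))) := by
  obtain ⟨m, rfl⟩ := hNeven.exists_two_nsmul
  rw [smul_eq_mul] at *
  have hm : m ≠ 0 := by omega
  have hlog : HasSum (fun n : ℕ => R ^ (2 * (n + 1)) / ((n : ℝ) + 1)) (-Real.log (1 - R ^ 2)) := by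
    have hR2 : |R ^ 2| < 1 := by
      rw [abs_of_pos (by positivity)]
      exact pow_lt_one₀ hR0.le hR1 two_ne_zero
    simpa only [pow_mul] using Real.hasSum_pow_div_log_of_abs_lt_one hR2
  have hsum : ∀ l ∈ Finset.Ico 1 (2 * m), Summable fun n : ℕ =>
      Real.cos (2 * Real.pi * (n + 1) * l / (2 * m : ℕ)) * (-1 : ℝ) ^ l *
        R ^ (2 * (n + 1)) / (n + 1) := by
    intro l _
    refine hlog.summable.of_norm_bounded fun n => ?_
    rw [mul_div_assoc, norm_mul, norm_mul, norm_pow, norm_neg, norm_one, one_pow, mul_one,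
      Real.norm_of_nonneg (by positivity : 0 ≤ R ^ (2 * (n + 1)) / ((n : ℝ) + 1))]
    exact mul_le_of_le_one_left (by positivity) (Real.abs_cos_le_one _)
  have key : ∑ l ∈ Finset.Ico 1 (2 * m), ∑' n : ℕ,
      Real.cos (2 * Real.pi * (n + 1) * l / (2 * m : ℕ)) * (-1 : ℝ) ^ l *
        R ^ (2 * (n + 1)) / (n + 1) =
      Real.log (1 + R ^ (2 * m)) - Real.log (1 - R ^ (2 * m)) + Real.log (1 - R ^ 2) := by
    rw [← Summable.tsum_finsetSum hsum, ← sub_neg_eq_add,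
      ← ((hasSum_pow_div_of_dvd_add m hm R hR0 hR1).sub hlog).tsum_eq]
    refine tsum_congr fun n => ?_
    have h := sum_Ico_cos_mul_neg_one_pow m hm (n + 1)
    push_cast at h ⊢
    simp_rw [mul_div_assoc _ (R ^ (2 * (n + 1)))]
    rw [← Finset.sum_mul, h]
    ring
  have hx : R ^ (2 * m) < 1 := pow_lt_one₀ hR0.le hR1 (by omega)
  have hN0 : (0 : ℝ) < (2 * m : ℕ) := by exact_mod_cast (by omega : 0 < 2 * m)
  have h1 : 0 < 1 - R ^ (2 * m) := by linarith
  have h2 : 0 < 1 + R ^ (2 * m) := by positivity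
  rw [key, mul_div_right_comm, Real.log_mul (by positivity) (by positivity),
    Real.log_mul (by positivity) (by positivity), Real.log_div h2.ne' h1.ne']
  ring
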